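/- arXiv:math/0506078 — 5 statements merged into one kernel-verified Lean document; each statement's English description precedes it below -/
import Mathlib

section
/- For every α ∈ 𝕂 there exists a positive integer s such that: (i) if |α| < 1 then α^{q^{ns}} → 0 in 𝕂 as n → ∞; (ii) if |α| = 1 then there exists c ∈ 𝕂 with c ≠ 0 and c^{q^s} = c (so c lies in the algebraic closure of 𝔽_q inside 𝕂) such that α^{q^{ns}} → c as n → ∞; (iii) if |α| > 1 then |α^{q^{ns}}| → ∞ as n → ∞. (Here α^{q^{ns}} is the ns-fold Frobenius twist α^{(ns)}.) [Paper's Lemma 'ConstantTwist'.] -/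
open Filter

section Residue

open Polynomial

variable {K : Type*} [NormedField K] [IsUltrametricDist K] {F : Subfield K}

theorem norm_le_one_of_norm_sub_lt_one {x y : K} (hx : ‖x‖ ≤ 1) (h : ‖x - y‖ < 1) : ‖y‖ ≤ 1 := by
  have := IsUltrametricDist.norm_add_le_max x (-(x - y))
  rw [norm_neg, neg_sub, add_sub_cancel] at this
  exact this.trans (max_le hx h.le)

theorem norm_aeval_eq_pow_natDegree (hF : ∀ c ∈ F, c ≠ 0 → ‖c‖ = 1) {θ : K} (hθ : 1 < ‖θ‖)
    (f : F[X]) (hf : f ≠ 0) : ‖aeval θ f‖ = ‖θ‖ ^ f.natDegree := by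
  induction hn : f.natDegree using Nat.strong_induction_on generalizing f with
  | _ n ih =>
    have hlead : ‖aeval θ (monomial f.natDegree f.leadingCoeff)‖ = ‖θ‖ ^ n := by
      rw [aeval_monomial, norm_mul, norm_pow, hn]
      have : ‖algebraMap F K f.leadingCoeff‖ = 1 :=
        hF _ f.leadingCoeff.2 (by simpa using hf)
      rw [this, one_mul]
    have hlt : ‖aeval θ f.eraseLead‖ < ‖θ‖ ^ n := by
      by_cases h0 : f.eraseLead = 0
      · rw [h0, map_zero, norm_zero]; positivity
      · have hdeg : f.eraseLead.natDegree < n := by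
          rcases f.eraseLead_natDegree_lt_or_eraseLead_eq_zero with h | h
          · exact hn ▸ h
          · exact absurd h h0
        rw [ih _ hdeg _ h0 rfl]
        exact pow_lt_pow_right₀ hθ hdeg
    rw [← f.eraseLead_add_monomial_natDegree_leadingCoeff, map_add,
      IsUltrametricDist.norm_add_eq_max_of_norm_ne_norm (hlead ▸ hlt.ne), hlead]
    exact max_eq_right hlt.le

theorem exists_norm_sub_lt_one_of_mem_closure (hF : ∀ c ∈ F, c ≠ 0 → ‖c‖ = 1) {θ : K}
    (hθ : 1 < ‖θ‖) {x : K} (hx : x ∈ Subfield.closure ({θ} ∪ (F : Set K))) (hx1 : ‖x‖ ≤ 1) :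
    ∃ c ∈ F, ‖x - c‖ < 1 := by
  rcases hx1.lt_or_eq with hlt | heq
  · exact ⟨0, F.zero_mem, by simpa using hlt⟩
  have hle : Subring.closure ({θ} ∪ (F : Set K)) ≤ (aeval (R := F) θ).toRingHom.range := by
    rw [Subring.closure_le]
    rintro y (rfl | hy)
    · exact ⟨X, aeval_X y⟩
    · exact ⟨C ⟨y, hy⟩, aeval_C θ _⟩
  obtain ⟨y, hy, z, hz, rfl⟩ := Subfield.mem_closure_iff.1 hx
  obtain ⟨f, rfl⟩ := hle hy
  obtain ⟨g, rfl⟩ := hle hz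
  change ‖aeval θ f / aeval θ g‖ = 1 at heq
  change ∃ c ∈ F, ‖aeval θ f / aeval θ g - c‖ < 1
  have hf : f ≠ 0 := by rintro rfl; simp at heq
  have hg : g ≠ 0 := by rintro rfl; simp at heq
  have hgn : 0 < ‖aeval θ g‖ := by
    rw [norm_aeval_eq_pow_natDegree hF hθ g hg]; positivity
  have hdeg : f.natDegree = g.natDegree := by
    rw [norm_div, div_eq_one_iff_eq hgn.ne', norm_aeval_eq_pow_natDegree hF hθ f hf,
      norm_aeval_eq_pow_natDegree hF hθ g hg] at heq
    exact pow_right_injective₀ (by positivity) hθ.ne' heq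
  set c : F := f.leadingCoeff / g.leadingCoeff with hc
  have hg0 : g.leadingCoeff ≠ 0 := leadingCoeff_ne_zero.2 hg
  have hc0 : c ≠ 0 := div_ne_zero (leadingCoeff_ne_zero.2 hf) hg0
  refine ⟨c, c.2, ?_⟩
  have hsub : aeval θ f / aeval θ g - c = aeval θ (f - C c * g) / aeval θ g := by
    have : aeval θ g ≠ 0 := norm_pos_iff.1 hgn
    rw [map_sub, map_mul, aeval_C, sub_div, mul_div_cancel_right₀ _ this]
    rfl
  rw [hsub, norm_div, div_lt_one hgn]
  by_cases h0 : f - C c * g = 0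
  · simpa [h0] using hgn
  have hlt : (f - C c * g).degree < f.degree := by
    apply degree_sub_lt_left _ hf
    · rw [leadingCoeff_mul, leadingCoeff_C, hc, div_mul_cancel₀ _ hg0]
    · rw [degree_C_mul hc0, degree_eq_natDegree hf, degree_eq_natDegree hg, hdeg]
  rw [norm_aeval_eq_pow_natDegree hF hθ _ h0, norm_aeval_eq_pow_natDegree hF hθ g hg, ← hdeg]
  exact pow_lt_pow_right₀ hθ (natDegree_lt_natDegree h0 hlt)

theorem exists_norm_sub_lt_one_of_mem_topologicalClosure {L : Subfield K}
    (hL : ∀ x ∈ L, ‖x‖ ≤ 1 → ∃ c ∈ F, ‖x - c‖ < 1) {x : K} (hx : x ∈ L.topologicalClosure)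
    (hx1 : ‖x‖ ≤ 1) : ∃ c ∈ F, ‖x - c‖ < 1 := by
  have hx' : x ∈ closure (L : Set K) := hx
  obtain ⟨y, hy, hxy⟩ := Metric.mem_closure_iff.1 hx' 1 one_pos
  rw [dist_eq_norm] at hxy
  have hy1 : ‖y‖ ≤ 1 := norm_le_one_of_norm_sub_lt_one hx1 hxy
  obtain ⟨c, hc, hyc⟩ := hL y hy hy1
  refine ⟨c, hc, ?_⟩
  rw [← sub_add_sub_cancel x y c]
  exact (IsUltrametricDist.norm_add_le_max _ _).trans_lt (max_lt hxy hyc)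

theorem exists_isAlgebraic_norm_sub_lt_one [IsAlgClosed K] (hF : ∀ c ∈ F, c ≠ 0 → ‖c‖ = 1)
    {L : Subfield K} (hL : ∀ x ∈ L, ‖x‖ ≤ 1 → ∃ c ∈ F, ‖x - c‖ < 1) {x : K}
    (hx : IsAlgebraic L x) (hx1 : ‖x‖ ≤ 1) : ∃ r : K, IsAlgebraic F r ∧ ‖x - r‖ < 1 := by
  obtain ⟨P, hP0, hPx⟩ := hx
  obtain ⟨i, hi, hmax⟩ := P.support.exists_max_image (fun j => ‖(P.coeff j : K)‖)
    (nonempty_support_iff.2 hP0)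
  have hPi : P.coeff i ≠ 0 := mem_support_iff.1 hi
  have hPi' : 0 < ‖(P.coeff i : K)‖ := norm_pos_iff.2 (by simpa using hPi)
  have hle (j : ℕ) : ‖((P.coeff j / P.coeff i : L) : K)‖ ≤ 1 := by
    push_cast
    rw [norm_div, div_le_one hPi']
    by_cases hj : j ∈ P.support
    · exact hmax j hj
    · simp [notMem_support_iff.1 hj]
  choose c hcF hc using fun j => hL _ (P.coeff j / P.coeff i).2 (hle j)
  let Q : F[X] := ∑ j ∈ Finset.range (P.natDegree + 1), monomial j (⟨c j, hcF j⟩ : F)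
  have hQ0 : Q ≠ 0 := by
    intro h
    have hi' : i ∈ Finset.range (P.natDegree + 1) :=
      Finset.mem_range.2 (Nat.lt_succ_of_le (le_natDegree_of_ne_zero hPi))
    have hcoeff : Q.coeff i = ⟨c i, hcF i⟩ := by
      simp only [Q, finsetSum_coeff, coeff_monomial]
      rw [Finset.sum_ite_eq' _ i, if_pos hi']
    have hci : c i = 0 := by
      rw [h, coeff_zero] at hcoeff
      exact (congrArg Subtype.val hcoeff).symm
    have := hc i
    rw [hci, div_self hPi] at this
    simp at this
  have hQx : ‖aeval x Q‖ < 1 := by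
    have hP : ∑ j ∈ Finset.range (P.natDegree + 1),
        ((P.coeff j / P.coeff i : L) : K) * x ^ j = 0 := by
      have h := hPx
      rw [aeval_eq_sum_range] at h
      have h2 := congrArg (fun y => (P.coeff i : K)⁻¹ * y) h
      simp only [mul_zero, Finset.mul_sum] at h2
      rw [← h2]
      refine Finset.sum_congr rfl fun j _ => ?_
      rw [Algebra.smul_def, Subfield.coe_div, div_eq_inv_mul, mul_assoc]
      rfl
    have hQ : aeval x Q = -∑ j ∈ Finset.range (P.natDegree + 1),
        (((P.coeff j / P.coeff i : L) : K) - c j) * x ^ j := by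
      simp only [sub_mul, Finset.sum_sub_distrib, hP, zero_sub, neg_neg, Q, map_sum,
        aeval_monomial]
      rfl
    obtain ⟨j, -, hj⟩ := IsUltrametricDist.exists_norm_finsetSum_le
      (Finset.range (P.natDegree + 1))
      (fun j => (((P.coeff j / P.coeff i : L) : K) - c j) * x ^ j)
    rw [hQ, norm_neg]
    refine hj.trans_lt ?_
    rw [norm_mul, norm_pow]
    exact (mul_le_of_le_one_right (norm_nonneg _) (pow_le_one₀ (norm_nonneg _) hx1)).trans_lt
      (hc j)
  by_contra! hfar
  refine hQx.not_ge ?_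
  rw [← eval_map_algebraMap, (IsAlgClosed.splits _).eval_eq_prod_roots, norm_mul,
    leadingCoeff_map]
  have hlead : ‖algebraMap F K Q.leadingCoeff‖ = 1 :=
    hF _ Q.leadingCoeff.2 (by simpa using hQ0)
  rw [hlead, one_mul, ← coe_nnnorm, ← NNReal.coe_one, NNReal.coe_le_coe]
  have hprod : ‖((Q.map (algebraMap F K)).roots.map fun a => x - a).prod‖₊ =
      ((Q.map (algebraMap F K)).roots.map fun a => ‖x - a‖₊).prod := by
    change nnnormHom _ = _
    rw [map_multiset_prod, Multiset.map_map]
    rfl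
  rw [hprod]
  refine Multiset.one_le_prod_of_one_le fun y hy => ?_
  obtain ⟨r, hr, rfl⟩ := Multiset.mem_map.1 hy
  refine hfar r ⟨Q, hQ0, ?_⟩
  rw [← eval_map_algebraMap]
  exact isRoot_of_mem_roots hr

end Residue

theorem exists_pow_prime_pow_eq_self_of_isAlgebraic {F K : Type*} [Field F] [Finite F] [Field K]
    [Algebra F K] (p : ℕ) [CharP K p] {r : K} (hr : IsAlgebraic F r) :
    ∃ n : ℕ, 0 < n ∧ r ^ p ^ n = r := by
  let E := IntermediateField.adjoin F {r}
  have : FiniteDimensional F E := IntermediateField.adjoin.finiteDimensional hr.isIntegral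
  have : Finite E := Module.finite_of_finite F
  have := Fintype.ofFinite E
  obtain ⟨p', hp', n, -, hn⟩ := FiniteField.card' E
  have : CharP E p := (algebraMap E K).charP (algebraMap E K).injective p
  obtain rfl : p' = p := CharP.eq E hp' this
  refine ⟨n, n.pos, ?_⟩
  have h := FiniteField.pow_card (IntermediateField.AdjoinSimple.gen F r)
  rw [hn] at h
  simpa using congrArg (algebraMap E K) h

theorem pow_pow_mul_eq_self {M : Type*} [Monoid M] {c : M} {q s : ℕ} (h : c ^ q ^ s = c) (n : ℕ) :
    c ^ q ^ (n * s) = c := by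
  induction n with
  | zero => simp
  | succ n ih => rw [Nat.succ_mul, pow_add, pow_mul, ih, h]

/-- **Paper's Lemma `ConstantTwist`.**
Let `𝕂` be an algebraically closed field of characteristic `p`, complete with respect to a
multiplicative nonarchimedean absolute value (modelled as a complete nonarchimedean normed
field), containing `𝔽_q` (`q = p^m`) and an element `θ` with `‖θ‖ = q`, and such that the
elements algebraic over `k_∞` (the topological closure of `k = 𝔽_q(θ)`) are dense in `𝕂`.
Then for every `α ∈ 𝕂` there is a positive integer `s` such that:
(i) if `‖α‖ < 1` then `α^(q^(n*s)) → 0`;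
(ii) if `‖α‖ = 1` then `α^(q^(n*s)) → c` for some `c ≠ 0` with `c^(q^s) = c`;
(iii) if `‖α‖ > 1` then `‖α^(q^(n*s))‖ → ∞`. -/
theorem constant_twist
    (p m q : ℕ) [Fact p.Prime] (hm : 0 < m) (hq : q = p ^ m)
    (𝕂 : Type) [NormedField 𝕂] [CompleteSpace 𝕂] [IsAlgClosed 𝕂] [CharP 𝕂 p]
    (hna : IsNonarchimedean (fun x : 𝕂 => ‖x‖))
    (θ : 𝕂) (hθ : ‖θ‖ = q)
    (hdense : Dense {x : 𝕂 |
      IsAlgebraic ((Subfield.closure ({θ} ∪ {c : 𝕂 | c ^ q = c})).topologicalClosure) x})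
    (α : 𝕂) :
    ∃ s : ℕ, 0 < s ∧
      (‖α‖ < 1 → Tendsto (fun n : ℕ => α ^ q ^ (n * s)) atTop (nhds 0)) ∧
      (‖α‖ = 1 → ∃ c : 𝕂, c ≠ 0 ∧ c ^ q ^ s = c ∧
        Tendsto (fun n : ℕ => α ^ q ^ (n * s)) atTop (nhds c)) ∧
      (1 < ‖α‖ → Tendsto (fun n : ℕ => ‖α ^ q ^ (n * s)‖) atTop atTop) := by
  have hp : 1 < p := (Fact.out : p.Prime).one_lt
  have hq1 : 1 < q := hq ▸ Nat.one_lt_pow hm.ne' hp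
  have : IsUltrametricDist 𝕂 := IsUltrametricDist.isUltrametricDist_of_isNonarchimedean_norm hna
  have hexp (s : ℕ) (hs : 0 < s) : Tendsto (fun n : ℕ => q ^ (n * s)) atTop atTop :=
    (tendsto_pow_atTop_atTop_of_one_lt hq1).comp (tendsto_id.atTop_mul_const' hs)
  have hsmall (s : ℕ) (hs : 0 < s) (β : 𝕂) (hβ : ‖β‖ < 1) :
      Tendsto (fun n : ℕ => β ^ q ^ (n * s)) atTop (nhds 0) :=
    (tendsto_pow_atTop_nhds_zero_of_norm_lt_one hβ).comp (hexp s hs)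
  by_cases hα : ‖α‖ = 1
  swap
  · refine ⟨1, one_pos, hsmall 1 one_pos α, fun h => absurd h hα, fun h => ?_⟩
    simp only [norm_pow]
    exact (tendsto_pow_atTop_atTop_of_one_lt h).comp (hexp 1 one_pos)
  let F : Subfield 𝕂 := (iterateFrobenius 𝕂 p m).eqLocusField (RingHom.id 𝕂)
  have hFmem (c : 𝕂) : c ∈ F ↔ c ^ q = c := by
    rw [RingHom.mem_eqLocusField, iterateFrobenius_def, hq]; rfl
  have hFset : (F : Set 𝕂) = {c : 𝕂 | c ^ q = c} := Set.ext hFmem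
  have hFfin : Finite F := by
    have hX : (Polynomial.X ^ q - Polynomial.X : Polynomial 𝕂) ≠ 0 :=
      FiniteField.X_pow_card_sub_X_ne_zero 𝕂 hq1
    refine (Polynomial.finite_setOfPred_isRoot hX).subset fun c hc => ?_
    simpa [sub_eq_zero] using (hFmem c).1 hc
  have hFnorm : ∀ c ∈ F, c ≠ 0 → ‖c‖ = 1 := by
    intro c hc hc0
    have h : c ^ (q - 1) = 1 := by
      apply mul_right_cancel₀ hc0
      rw [← pow_succ, Nat.sub_add_cancel hq1.le, one_mul, (hFmem c).1 hc]
    rw [← pow_eq_one_iff_of_nonneg (norm_nonneg c) (Nat.sub_ne_zero_of_lt hq1), ← norm_pow, h,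
      norm_one]
  have hθ1 : 1 < ‖θ‖ := by rw [hθ]; exact_mod_cast hq1
  rw [← hFset] at hdense
  obtain ⟨x, hx, hxα⟩ := hdense.exists_dist_lt α one_pos
  rw [dist_eq_norm] at hxα
  have hx1 : ‖x‖ ≤ 1 := norm_le_one_of_norm_sub_lt_one hα.le hxα
  obtain ⟨c, hcalg, hxc⟩ := exists_isAlgebraic_norm_sub_lt_one hFnorm
    (fun y hy => exists_norm_sub_lt_one_of_mem_topologicalClosure
      (fun z hz => exists_norm_sub_lt_one_of_mem_closure hFnorm hθ1 hz) hy) hx hx1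
  have hαc : ‖α - c‖ < 1 := by
    rw [← sub_add_sub_cancel α x c]
    exact (IsUltrametricDist.norm_add_le_max _ _).trans_lt (max_lt hxα hxc)
  obtain ⟨s, hs, hcs⟩ := exists_pow_prime_pow_eq_self_of_isAlgebraic p hcalg
  have hcq : c ^ q ^ s = c := by
    rw [hq, ← pow_mul]
    exact pow_pow_mul_eq_self hcs m
  refine ⟨s, hs, hsmall s hs α, fun _ => ⟨c, ?_, hcq, ?_⟩, fun h => absurd hα h.ne'⟩
  · rintro rfl
    rw [sub_zero, hα] at hαc
    exact lt_irrefl _ hαc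
  · rw [← tendsto_sub_nhds_zero_iff]
    refine (hsmall s hs _ hαc).congr fun n => ?_
    rw [hq, ← pow_mul, sub_pow_char_pow, pow_mul, ← hq, pow_pow_mul_eq_self hcq]
end

section
/- Let (F, K, L) be a σ-admissible triple and Φ ∈ GL_r(K). Then the solution set Sol(Φ) := { ψ ∈ L^r : σ(ψ) = Φ·ψ } is an F-linear subspace of L^r (viewed as an F-vector space), and its dimension over F is at most r. [Paper's Corollary 'SolDimBound'.] -/
/-- The set of solutions of `σ ψ = Φ ψ`, as a module over the fixed field of `σ`. -/
def semilinearSolutions {L : Type*} [Field L] (σ : L ≃+* L) (F : Subfield L)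
    (hF : ∀ x ∈ F, σ x = x) {n : Type*} [Fintype n] (Φ : Matrix n n L) :
    Submodule F (n → L) where
  carrier := {ψ | (fun j => σ (ψ j)) = Φ.mulVec ψ}
  zero_mem' := by
    ext j
    simp
  add_mem' {a b} ha hb := by
    simp only [Set.mem_ofPred_eq] at ha hb ⊢
    rw [Matrix.mulVec_add, ← ha, ← hb]
    ext j
    simp
  smul_mem' c a ha := by
    simp only [Set.mem_ofPred_eq] at ha ⊢
    rw [Matrix.mulVec_smul, ← ha]
    ext j
    simp [Subfield.smul_def, hF c c.2]

/-- Solutions of `σ ψ = Φ ψ`, with `Φ` invertible, that are linearly independent over the fixed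
field of `σ` are linearly independent over the whole field. -/
theorem linearIndepOn_of_semilinear_solutions {L : Type*} [Field L] (σ : L ≃+* L)
    (F : Subfield L) (hF : ∀ x, σ x = x → x ∈ F) {n ι : Type*} [Fintype n] [DecidableEq n]
    (Φ : Matrix n n L) (hΦ : Φ.det ≠ 0) (v : ι → n → L)
    (hv : ∀ i, (fun j => σ (v i j)) = Φ.mulVec (v i)) (s : Finset ι)
    (hs : LinearIndepOn F v (s : Set ι)) : LinearIndepOn L v (s : Set ι) := by
  classical
  induction s using Finset.induction_on with
  | empty => simp
  | insert a s ha ih =>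
    rw [Finset.coe_insert, linearIndepOn_insert (by simpa using ha)] at hs ⊢
    have hsL := ih hs.1
    refine ⟨hsL, fun hmem => hs.2 ?_⟩
    obtain ⟨c, hc⟩ : ∃ c : ι → L, ∑ i ∈ s, c i • v i = v a := by
      obtain ⟨c, hc⟩ := (Submodule.mem_span_image_finset_iff_exists_fun L).1 hmem
      refine ⟨fun i => if h : i ∈ s then c ⟨i, h⟩ else 0, ?_⟩
      rw [← hc, ← Finset.sum_coe_sort]
      simp
    have hσ : ∑ i ∈ s, σ (c i) • v i = v a := by
      apply Matrix.mulVec_injective_of_isUnit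
        ((Matrix.isUnit_iff_isUnit_det Φ).2 (isUnit_iff_ne_zero.2 hΦ))
      rw [← hv a, Matrix.mulVec_sum]
      ext j
      simp [← hc, Matrix.mulVec_smul, ← hv]
    have hfix : ∀ i ∈ s, c i ∈ F := by
      intro i hi
      refine hF _ (sub_eq_zero.1 ?_)
      refine linearIndepOn_finset_iff.1 hsL (fun i => σ (c i) - c i) ?_ i hi
      simp [sub_smul, hσ, hc]
    rw [← hc]
    exact Submodule.sum_mem _ fun i hi =>
      Submodule.smul_mem _ (⟨c i, hfix i hi⟩ : F)
        (Submodule.subset_span (Set.mem_image_of_mem v hi))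

/-- **Paper's Corollary `SolDimBound`.**  Let `(F, K, L)` be a σ-admissible triple and
`Φ ∈ GL_r(K)`.  Then `Sol(Φ) = {ψ ∈ L^r : σ(ψ) = Φψ}` is an `F`-subspace of `L^r` of
dimension at most `r`. -/
theorem solution_space_dim_le
    (L : Type) [Field L] (σ : L ≃+* L) (F K : Subfield L) (hFK : F ≤ K)
    (hfix : ∀ x : L, σ x = x ↔ x ∈ F)
    (hσK : ∀ x : L, x ∈ K ↔ σ x ∈ K)
    [Algebra.IsSeparable K L]
    (r : ℕ) (Φ : Matrix (Fin r) (Fin r) L)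
    (hΦK : ∀ i j, Φ i j ∈ K) (hΦdet : Φ.det ≠ 0) :
    ∃ S : Submodule F (Fin r → L),
      (S : Set (Fin r → L)) = {ψ : Fin r → L | (fun j => σ (ψ j)) = Φ.mulVec ψ} ∧
      Module.rank F S ≤ r := by
  refine ⟨semilinearSolutions σ F (fun x hx => (hfix x).2 hx) Φ, rfl, ?_⟩
  refine rank_le fun s hs => ?_
  have hF : LinearIndepOn F
      (fun x : semilinearSolutions σ F (fun x hx => (hfix x).2 hx) Φ => (x : Fin r → L))
      (s : Set _) :=
    LinearIndependent.map' hs (Submodule.subtype _) (Submodule.ker_subtype _)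
  have hL := linearIndepOn_of_semilinear_solutions σ F (fun x => (hfix x).1) Φ hΦdet _
    (fun x => x.2) s hF
  simpa using hL.linearIndependent.fintype_card_le_finrank
end

section
/- The extension map 𝔞 ↦ 𝔞·L[X, 1/det X] and the contraction map 𝔟 ↦ 𝔟 ∩ F[X, 1/det X] are mutually inverse bijections between the set of all ideals 𝔞 of F[X, 1/det X] and the set of all ideals 𝔟 of L[X, 1/det X] with σ₀(𝔟) = 𝔟. In particular, (𝔞·L[X, 1/det X]) ∩ F[X, 1/det X] = 𝔞 for every ideal 𝔞 of F[X, 1/det X], and every σ₀-invariant ideal 𝔟 of L[X, 1/det X] is generated by 𝔟 ∩ F[X, 1/det X]. [Paper's Lemma 'SigmaIdealCorrespondence'.] -/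
set_option synthInstance.maxHeartbeats 1000000
set_option maxHeartbeats 1000000

/-- The determinant of the generic `r × r` matrix `(X_{ij})`, as a multivariate polynomial. -/
noncomputable def detPoly (E : Type) [CommRing E] (r : ℕ) : MvPolynomial (Fin r × Fin r) E :=
  (Matrix.of fun i j : Fin r => MvPolynomial.X (i, j)).det

/-- The coordinate ring `E[X, 1/det X]` of `GL_r` over `E`: the localization of the
polynomial ring in the `r²` variables `X_{ij}` at `det X`. -/
abbrev CoordRing (E : Type) [CommRing E] (r : ℕ) := Localization.Away (detPoly E r)

theorem map_detPoly {R P : Type} [CommRing R] [CommRing P] (r : ℕ) (g : R →+* P) :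
    (MvPolynomial.map g) (detPoly R r) = detPoly P r := by
  unfold detPoly
  rw [RingHom.map_det]
  congr 1
  ext i j
  simp [RingHom.mapMatrix_apply, Matrix.map_apply]

theorem powers_le_comap_powers {R P : Type} [CommRing R] [CommRing P] (r : ℕ) (g : R →+* P) :
    Submonoid.powers (detPoly R r) ≤
      Submonoid.comap (MvPolynomial.map g).toMonoidHom (Submonoid.powers (detPoly P r)) := by
  refine Submonoid.powers_le.mpr ?_
  simp only [Submonoid.mem_comap, RingHom.toMonoidHom_eq_coe, MonoidHom.coe_coe, map_detPoly]
  exact Submonoid.mem_powers _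

/-- The ring homomorphism `R[X, 1/det X] → P[X, 1/det X]` induced by a ring homomorphism
`g : R →+* P` on coefficients (leaving the variables `X_{ij}` fixed). -/
noncomputable def coordMap {R P : Type} [CommRing R] [CommRing P] (r : ℕ) (g : R →+* P) :
    CoordRing R r →+* CoordRing P r :=
  IsLocalization.map (T := Submonoid.powers (detPoly P r))
    (Localization.Away (detPoly P r)) (MvPolynomial.map g)
    (powers_le_comap_powers r g)


theorem coordMap_algebraMap {R P : Type} [CommRing R] [CommRing P] (r : ℕ) (g : R →+* P)
    (p : MvPolynomial (Fin r × Fin r) R) :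
    coordMap r g (algebraMap _ _ p) =
      algebraMap _ (CoordRing P r) (MvPolynomial.map g p) :=
  IsLocalization.map_eq _ p

theorem coordMap_comp_algebraMap {R P : Type} [CommRing R] [CommRing P] (r : ℕ) (g : R →+* P) :
    (coordMap r g).comp (algebraMap (MvPolynomial (Fin r × Fin r) R) _) =
      (algebraMap _ (CoordRing P r)).comp (MvPolynomial.map g) :=
  RingHom.ext (coordMap_algebraMap r g)

theorem coordMap_comp {R P Q : Type} [CommRing R] [CommRing P] [CommRing Q] (r : ℕ)
    (g : R →+* P) (h : P →+* Q) :
    (coordMap r h).comp (coordMap r g) = coordMap r (h.comp g) := by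
  refine IsLocalization.ringHom_ext (Submonoid.powers (detPoly R r)) (RingHom.ext fun p => ?_)
  simp [coordMap_algebraMap, MvPolynomial.map_map]

section FieldExtension

attribute [local instance] MvPolynomial.algebraMvPolynomial

theorem MvPolynomial.faithfullyFlat_of_field (ι K E : Type*) [Field K] [Field E] [Algebra K E] :
    Module.FaithfullyFlat (MvPolynomial ι K) (MvPolynomial ι E) :=
  .of_linearEquiv _ _
    (Algebra.IsPushout.out (R := K) (S := MvPolynomial ι K) (R' := E)
      (S' := MvPolynomial ι E)).equiv.symm

theorem MvPolynomial.comap_map_map_of_field {ι K E : Type*} [Field K] [Field E] (g : K →+* E)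
    (I : Ideal (MvPolynomial ι K)) :
    (I.map (MvPolynomial.map g)).comap (MvPolynomial.map g) = I := by
  let := g.toAlgebra
  have := MvPolynomial.faithfullyFlat_of_field ι K E
  exact I.comap_map_eq_self_of_faithfullyFlat (B := MvPolynomial ι E)

end FieldExtension

theorem comap_map_coordMap {K E : Type} [Field K] [Field E] (r : ℕ) (g : K →+* E)
    (a : Ideal (CoordRing K r)) :
    (a.map (coordMap r g)).comap (coordMap r g) = a := by
  refine le_antisymm (fun z hz => ?_) Ideal.le_comap_map
  obtain ⟨p, s, rfl⟩ := IsLocalization.exists_mk'_eq (Submonoid.powers (detPoly K r)) z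
  rw [IsLocalization.mk'_mem_iff] at hz ⊢
  rw [Ideal.mem_comap, coordMap_algebraMap,
    ← IsLocalization.map_under (Submonoid.powers (detPoly K r)) _ a, Ideal.map_map,
    coordMap_comp_algebraMap, ← Ideal.map_map,
    IsLocalization.algebraMap_mem_map_algebraMap_iff (Submonoid.powers (detPoly E r))] at hz
  obtain ⟨_, ⟨n, rfl⟩, hn⟩ := hz
  beta_reduce at hn
  rw [← map_detPoly r g, ← map_pow, ← map_mul, ← Ideal.mem_comap,
    MvPolynomial.comap_map_map_of_field] at hn
  rw [← IsLocalization.map_under (Submonoid.powers (detPoly K r)) _ a,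
    IsLocalization.algebraMap_mem_map_algebraMap_iff (Submonoid.powers (detPoly K r))]
  exact ⟨_, ⟨n, rfl⟩, hn⟩

section Descent

variable {ι L : Type*} [Field L] (σ : L →+* L) (b : Ideal (MvPolynomial ι L))

theorem MvPolynomial.exists_map_eq_self_mem_of_map_le
    (hb : b.map (MvPolynomial.map σ) ≤ b) (p : MvPolynomial ι L) (hp : p ∈ b) (hp0 : p ≠ 0) :
    ∃ q ∈ b, q ≠ 0 ∧ q.support ⊆ p.support ∧ MvPolynomial.map σ q = q := by
  induction hn : p.support.card using Nat.strong_induction_on generalizing p with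
  | _ n ih =>
  obtain ⟨m, hm⟩ := MvPolynomial.ne_zero_iff.mp hp0
  set q := MvPolynomial.C (p.coeff m)⁻¹ * p with hq
  have hqb : q ∈ b := b.mul_mem_left _ hp
  have hqm : q.coeff m = 1 := by simp [hq, MvPolynomial.coeff_C_mul, hm]
  have hqs : q.support ⊆ p.support := fun k hk => by
    simp only [MvPolynomial.mem_support_iff, hq, MvPolynomial.coeff_C_mul] at hk ⊢
    exact right_ne_zero_of_mul hk
  by_cases h : MvPolynomial.map σ q = q
  · exact ⟨q, hqb, fun h0 => by simp [h0] at hqm, hqs, h⟩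
  have hds : (MvPolynomial.map σ q - q).support ⊆ p.support := fun k hk => by
    refine hqs ?_
    simp only [MvPolynomial.mem_support_iff, MvPolynomial.coeff_sub,
      MvPolynomial.coeff_map] at hk ⊢
    exact fun h0 => hk (by simp [h0])
  have hlt : (MvPolynomial.map σ q - q).support.card < n := by
    rw [← hn]
    refine Finset.card_lt_card ((Finset.ssubset_iff_of_subset hds).2 ⟨m, ?_, ?_⟩)
    · simpa using hm
    · simp [MvPolynomial.coeff_map, hqm]
  obtain ⟨t, ht, ht0, hts, hσ⟩ := ih _ hlt _
    (b.sub_mem (hb (Ideal.mem_map_of_mem _ hqb)) hqb) (sub_ne_zero.2 h) rfl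
  exact ⟨t, ht, ht0, hts.trans hds, hσ⟩

theorem MvPolynomial.mem_map_comap_map_subtype (F : Subfield L) (hF : ∀ x, σ x = x → x ∈ F)
    (hb : b.map (MvPolynomial.map σ) ≤ b) (p : MvPolynomial ι L) (hp : p ∈ b) :
    p ∈ (b.comap (MvPolynomial.map F.subtype)).map (MvPolynomial.map F.subtype) := by
  induction hn : p.support.card using Nat.strong_induction_on generalizing p with
  | _ n ih =>
  by_cases hp0 : p = 0
  · simp [hp0]
  obtain ⟨q, hqb, hq0, hqs, hσ⟩ := exists_map_eq_self_mem_of_map_le σ b hb p hp hp0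
  obtain ⟨m, hm⟩ := MvPolynomial.ne_zero_iff.mp hq0
  have hq : q ∈ (b.comap (MvPolynomial.map F.subtype)).map (MvPolynomial.map F.subtype) := by
    obtain ⟨u, rfl⟩ : q ∈ (MvPolynomial.map (σ := ι) F.subtype).range := by
      rw [← SetLike.mem_coe, RingHom.coe_range, MvPolynomial.mem_range_map_iff_coeffs_subset]
      intro x hx
      obtain ⟨k, -, rfl⟩ := MvPolynomial.mem_coeffs_iff.1 hx
      refine ⟨⟨_, hF _ ?_⟩, rfl⟩
      exact (MvPolynomial.coeff_map σ q k).symm.trans (congrArg (MvPolynomial.coeff k) hσ)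
    exact Ideal.mem_map_of_mem _ hqb
  set c := MvPolynomial.C (p.coeff m / q.coeff m) * q with hc
  have hlt : (p - c).support.card < n := by
    rw [← hn]
    refine Finset.card_lt_card ((Finset.ssubset_iff_of_subset fun k hk => ?_).2
      ⟨m, hqs (by simpa using hm), ?_⟩)
    · by_contra hk'
      have hkq := fun h => hk' (hqs h)
      simp only [MvPolynomial.mem_support_iff, not_not] at hk'
      replace hkq : q.coeff k = 0 := MvPolynomial.notMem_support_iff.1 hkq
      simp [hc, MvPolynomial.coeff_C_mul, hk', hkq] at hk
    · simp [hc, MvPolynomial.coeff_C_mul, hm]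
  have hpc := ih _ hlt _ (b.sub_mem hp (b.mul_mem_left _ hqb)) rfl
  simpa using Ideal.add_mem _ hpc (Ideal.mul_mem_left _ (MvPolynomial.C (p.coeff m / q.coeff m)) hq)

end Descent

theorem map_comap_coordMap_subtype {L : Type} [Field L] (σ : L →+* L) (r : ℕ) (F : Subfield L)
    (hF : ∀ x, σ x = x → x ∈ F) (b : Ideal (CoordRing L r))
    (hb : b.map (coordMap r σ) ≤ b) :
    (b.comap (coordMap r F.subtype)).map (coordMap r F.subtype) = b := by
  refine le_antisymm Ideal.map_comap_le ?_
  conv_lhs => rw [← IsLocalization.map_under (Submonoid.powers (detPoly L r)) _ b]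
  rw [Ideal.map_le_iff_le_comap]
  intro p hp
  have hstable : (b.under (MvPolynomial (Fin r × Fin r) L)).map (MvPolynomial.map σ) ≤
      b.under (MvPolynomial (Fin r × Fin r) L) := by
    rw [Ideal.map_le_iff_le_comap]
    intro q hq
    rw [Ideal.mem_comap, Ideal.under_def, Ideal.mem_comap, ← coordMap_algebraMap]
    exact hb (Ideal.mem_map_of_mem _ hq)
  refine (Ideal.map_le_iff_le_comap.2 fun u hu => ?_)
    (MvPolynomial.mem_map_comap_map_subtype σ _ F hF hstable p hp)
  rw [Ideal.mem_comap, Ideal.under_def, Ideal.mem_comap, ← coordMap_algebraMap] at hu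
  rw [Ideal.mem_comap, Ideal.mem_comap, ← coordMap_algebraMap]
  exact Ideal.mem_map_of_mem _ hu

/-- **Paper's Lemma `SigmaIdealCorrespondence`.**  Let `L` be a field, `σ` an automorphism
of `L` with fixed field `F`, and let `σ₀` be the automorphism of `L[X, 1/det X]` applying
`σ` to coefficients and fixing the variables.  Then extension and contraction along
`F[X, 1/det X] ⊆ L[X, 1/det X]` are mutually inverse bijections between ideals of
`F[X, 1/det X]` and `σ₀`-invariant ideals of `L[X, 1/det X]`. -/
theorem sigma_ideal_correspondence
    (L : Type) [Field L] (σ : L ≃+* L) (r : ℕ)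
    (F : Subfield L) (hF : ∀ x : L, σ x = x ↔ x ∈ F) :
    -- extension followed by contraction is the identity
    (∀ a : Ideal (CoordRing F r),
        Ideal.comap (coordMap r F.subtype) (Ideal.map (coordMap r F.subtype) a) = a) ∧
    -- extended ideals are σ₀-invariant
    (∀ a : Ideal (CoordRing F r),
        Ideal.map (coordMap r (σ : L →+* L)) (Ideal.map (coordMap r F.subtype) a) =
          Ideal.map (coordMap r F.subtype) a) ∧
    -- contraction followed by extension is the identity on σ₀-invariant ideals
    (∀ b : Ideal (CoordRing L r),
        Ideal.map (coordMap r (σ : L →+* L)) b = b →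
          Ideal.map (coordMap r F.subtype) (Ideal.comap (coordMap r F.subtype) b) = b) := by
  refine ⟨comap_map_coordMap r F.subtype, fun a => ?_, fun b hb =>
    map_comap_coordMap_subtype (σ : L →+* L) r F (fun x hx => (hF x).1 hx) b hb.le⟩
  have hσ : (σ : L →+* L).comp F.subtype = F.subtype := RingHom.ext fun x => (hF x).2 x.2
  rw [Ideal.map_map, coordMap_comp, hσ]
end

section
/- Let G be a group and let A and B be subsets of G with A nonempty. Suppose the map (u, v) ↦ (u, u⁻¹v) sends A × A into A × B and is a bijection from A × A onto A × B. Then: B is a subgroup of G; A is stable under right multiplication by elements of B (for all a ∈ A and b ∈ B, ab ∈ A); and under this right action A is a principal homogeneous space for B, i.e. the action is free and transitive: for all a, a' ∈ A there exists a unique b ∈ B with ab = a'. [Paper's Lemma 'SubgroupLemma'.] -/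
/-- **Paper's Lemma `SubgroupLemma`.**  Let `G` be a group and `A`, `B` subsets of `G`
with `A` nonempty.  If `(u, v) ↦ (u, u⁻¹v)` is a bijection from `A × A` onto `A × B`,
then `B` is a subgroup of `G`, `A` is stable under right multiplication by `B`, and `A`
is a principal homogeneous space (free and transitive right action) under `B`. -/
theorem subgroup_of_torsor_condition
    (G : Type) [Group G] (A B : Set G) (hA : A.Nonempty)
    (hbij : Set.BijOn (fun uv : G × G => (uv.1, uv.1⁻¹ * uv.2)) (A ×ˢ A) (A ×ˢ B)) :
    (∃ H : Subgroup G, (H : Set G) = B) ∧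
    (∀ a ∈ A, ∀ b ∈ B, a * b ∈ A) ∧
    (∀ a ∈ A, ∀ a' ∈ A, ∃! b : G, b ∈ B ∧ a * b = a') := by
  have div_mem : ∀ a ∈ A, ∀ a' ∈ A, a⁻¹ * a' ∈ B := fun a ha a' ha' =>
    (hbij.mapsTo (Set.mk_mem_prod ha ha')).2
  have mul_mem : ∀ a ∈ A, ∀ b ∈ B, a * b ∈ A := by
    intro a ha b hb
    obtain ⟨⟨u, v⟩, ⟨-, hv⟩, huv⟩ := hbij.surjOn (Set.mk_mem_prod ha hb)
    obtain ⟨rfl, rfl⟩ := Prod.mk.inj huv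
    simpa using hv
  obtain ⟨a, ha⟩ := hA
  refine ⟨⟨{ carrier := B, mul_mem' := ?_, one_mem' := ?_, inv_mem' := ?_ }, rfl⟩, mul_mem, ?_⟩
  · intro x y hx hy
    simpa [mul_assoc] using div_mem a ha _ (mul_mem _ (mul_mem a ha x hx) y hy)
  · simpa using div_mem a ha a ha
  · intro x hx
    simpa using div_mem _ (mul_mem a ha x hx) a ha
  · intro u hu v hv
    exact ⟨u⁻¹ * v, ⟨div_mem u hu v hv, mul_inv_cancel_left u v⟩,
      fun b hb => eq_inv_mul_of_mul_eq hb.2⟩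
end

section
/- Let λ ∈ 𝕂 be nonzero and suppose exp_C(λ) ∈ k̄ with exp_C(λ) ≠ 0. Then there exist α ∈ k̄ with α ≠ 0 and |α| < q^{q/(q−1)}, a polynomial f ∈ 𝔽_q[θ] ⊆ 𝕂 (an 𝔽_q-coefficient polynomial expression in θ), and an integer n ≥ 1, such that λ = θ^n · log_C(α) + f · π̃. [Paper's Lemma 'LogReduction' (Lemma 6.4.1).] -/
open Filter

/-- The subfield `k = 𝔽_q(θ)` of `𝕂` (here `𝔽_q ⊆ 𝕂` is the set of roots of `x^q = x`). -/
def kk (q : ℕ) (𝕂 : Type) [Field 𝕂] (θ : 𝕂) : Subfield 𝕂 :=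
  Subfield.closure ({θ} ∪ {c : 𝕂 | c ^ q = c})

/-- Partial sums of the Carlitz exponential `exp_C(z) = Σ z^{q^i}/D_i`,
where `D_i = (θ^{q^i}-θ)(θ^{q^i}-θ^q)⋯(θ^{q^i}-θ^{q^{i-1}})`. -/
noncomputable def expCPartial (q : ℕ) (𝕂 : Type) [Field 𝕂] (θ z : 𝕂) (N : ℕ) : 𝕂 :=
  ∑ i ∈ Finset.range N,
    z ^ q ^ i * (∏ j ∈ Finset.range i, (θ ^ q ^ i - θ ^ q ^ j))⁻¹

/-- Partial sums of the Carlitz logarithm `log_C(z) = Σ z^{q^i}/L_i`,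
where `L_i = (θ-θ^q)(θ-θ^{q²})⋯(θ-θ^{q^i})`. -/
noncomputable def logCPartial (q : ℕ) (𝕂 : Type) [Field 𝕂] (θ z : 𝕂) (N : ℕ) : 𝕂 :=
  ∑ i ∈ Finset.range N,
    z ^ q ^ i * (∏ j ∈ Finset.Icc 1 i, (θ - θ ^ q ^ j))⁻¹

section Carlitz

variable {𝕂 : Type} [NormedField 𝕂] {p m q : ℕ} {θ : 𝕂}

/-- On the open unit disc, a `q`-power series with integral coefficients and leading term `z`
converges to a value which is congruent to `z` modulo `z ^ 2`. -/
lemma exists_tendsto_sum_pow_of_norm_lt_one [CompleteSpace 𝕂] [IsUltrametricDist 𝕂]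
    (hq : 2 ≤ q) {a : ℕ → 𝕂} (ha0 : a 0 = 1) (ha : ∀ i, ‖a i‖ ≤ 1) {z : 𝕂} (hz : ‖z‖ < 1) :
    ∃ l, Tendsto (fun N => ∑ i ∈ Finset.range N, z ^ q ^ i * a i) atTop (nhds l) ∧
      ‖l - z‖ ≤ ‖z‖ ^ 2 := by
  have hterm : ∀ i k, k ≤ q ^ i → ‖z ^ q ^ i * a i‖ ≤ ‖z‖ ^ k := fun i k hk => by
    rw [norm_mul, norm_pow]
    exact (mul_le_of_le_one_right (by positivity) (ha i)).trans
      (pow_le_pow_of_le_one (norm_nonneg z) hz.le hk)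
  have hsum : Summable fun i => z ^ q ^ i * a i :=
    Summable.of_norm_bounded (summable_geometric_of_lt_one (norm_nonneg z) hz)
      fun i => hterm i i (Nat.lt_pow_self hq).le
  refine ⟨_, hsum.hasSum.tendsto_sum_nat, ?_⟩
  have hbound : ∀ N, ‖∑ i ∈ Finset.range (N + 1), z ^ q ^ i * a i - z‖ ≤ ‖z‖ ^ 2 := fun N => by
    induction N with
    | zero => simp [ha0]
    | succ N ih =>
      rw [Finset.sum_range_succ, add_sub_right_comm]
      refine (IsUltrametricDist.norm_add_le_max _ _).trans (max_le ih (hterm _ _ ?_))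
      exact hq.trans (Nat.le_self_pow (by omega) q)
  exact le_of_tendsto'
    (((hsum.hasSum.tendsto_sum_nat.comp (tendsto_add_atTop_nat 1)).sub_const z).norm) hbound

lemma norm_pow_sub_pow_of_lt [IsUltrametricDist 𝕂] (hθ : 1 < ‖θ‖) {a b : ℕ} (hab : b < a) :
    ‖θ ^ a - θ ^ b‖ = ‖θ‖ ^ a := by
  have h : ‖θ ^ b‖ < ‖θ ^ a‖ := by
    simpa only [norm_pow] using pow_lt_pow_right₀ hθ hab
  rw [sub_eq_add_neg, IsUltrametricDist.norm_add_eq_max_of_norm_ne_norm (by simpa using h.ne'),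
    norm_neg, max_eq_left h.le, norm_pow]

lemma norm_expC_coeff_le_one [IsUltrametricDist 𝕂] (hq : 2 ≤ q) (hθ : 1 < ‖θ‖) (i : ℕ) :
    ‖(∏ j ∈ Finset.range i, (θ ^ q ^ i - θ ^ q ^ j))⁻¹‖ ≤ 1 := by
  rw [norm_inv, norm_prod]
  refine inv_le_one_of_one_le₀ (Finset.prod_induction _ (1 ≤ ·)
    (fun _ _ => one_le_mul_of_one_le_of_one_le) le_rfl fun j hj => ?_)
  rw [norm_pow_sub_pow_of_lt hθ (Nat.pow_lt_pow_right hq (Finset.mem_range.1 hj))]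
  exact one_le_pow₀ hθ.le

lemma norm_sub_pow_pow [IsUltrametricDist 𝕂] (hq : 2 ≤ q) (hθ : 1 < ‖θ‖) {j : ℕ} (hj : 1 ≤ j) :
    ‖θ - θ ^ q ^ j‖ = ‖θ‖ ^ q ^ j := by
  rw [norm_sub_rev]
  simpa using norm_pow_sub_pow_of_lt hθ (a := q ^ j) (b := 1) (Nat.one_lt_pow (by omega) hq)

lemma norm_logC_coeff_le_one [IsUltrametricDist 𝕂] (hq : 2 ≤ q) (hθ : 1 < ‖θ‖) (i : ℕ) :
    ‖(∏ j ∈ Finset.Icc 1 i, (θ - θ ^ q ^ j))⁻¹‖ ≤ 1 := by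
  rw [norm_inv, norm_prod]
  refine inv_le_one_of_one_le₀ (Finset.prod_induction _ (1 ≤ ·)
    (fun _ _ => one_le_mul_of_one_le_of_one_le) le_rfl fun j hj => ?_)
  rw [norm_sub_pow_pow hq hθ (Finset.mem_Icc.1 hj).1]
  exact one_le_pow₀ hθ.le

lemma exists_tendsto_expCPartial [CompleteSpace 𝕂] [IsUltrametricDist 𝕂]
    (hq : 2 ≤ q) (hθ : 1 < ‖θ‖) {z : 𝕂} (hz : ‖z‖ < 1) :
    ∃ x, Tendsto (expCPartial q 𝕂 θ z) atTop (nhds x) ∧ ‖x - z‖ ≤ ‖z‖ ^ 2 :=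
  exists_tendsto_sum_pow_of_norm_lt_one hq (by simp) (norm_expC_coeff_le_one hq hθ) hz

lemma exists_tendsto_logCPartial [CompleteSpace 𝕂] [IsUltrametricDist 𝕂]
    (hq : 2 ≤ q) (hθ : 1 < ‖θ‖) {z : 𝕂} (hz : ‖z‖ < 1) :
    ∃ l, Tendsto (logCPartial q 𝕂 θ z) atTop (nhds l) ∧ ‖l - z‖ ≤ ‖z‖ ^ 2 :=
  exists_tendsto_sum_pow_of_norm_lt_one hq (by simp) (norm_logC_coeff_le_one hq hθ) hz

lemma norm_eq_of_norm_sub_le_sq [IsUltrametricDist 𝕂] {x z : 𝕂} (hz : ‖z‖ < 1)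
    (h : ‖x - z‖ ≤ ‖z‖ ^ 2) : ‖x‖ = ‖z‖ := by
  rcases (norm_nonneg z).eq_or_lt with h0 | h0
  · have hz0 : z = 0 := norm_eq_zero.1 h0.symm
    subst hz0
    simpa using h
  · have hlt : ‖x - z‖ < ‖z‖ := h.trans_lt (by nlinarith)
    rw [← sub_add_cancel x z, IsUltrametricDist.norm_add_eq_max_of_norm_ne_norm hlt.ne,
      max_eq_right hlt.le]

section Frobenius

variable [Fact p.Prime] [CharP 𝕂 p]

lemma add_pow_of_eq_prime_pow (hq : q = p ^ m) (x y : 𝕂) (i : ℕ) :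
    (x + y) ^ q ^ i = x ^ q ^ i + y ^ q ^ i := by
  rw [hq, ← pow_mul]
  exact add_pow_char_pow ..

lemma sub_pow_of_eq_prime_pow (hq : q = p ^ m) (x y : 𝕂) :
    (x - y) ^ q = x ^ q - y ^ q := by
  rw [hq]
  exact sub_pow_char_pow ..

lemma sum_pow_of_eq_prime_pow (hq : q = p ^ m) (s : Finset ℕ) (g : ℕ → 𝕂) :
    (∑ i ∈ s, g i) ^ q = ∑ i ∈ s, g i ^ q := by
  rw [hq]
  exact sum_pow_char_pow ..

/-- The functional equation `exp_C (θ z) = θ exp_C z + (exp_C z) ^ q` on partial sums. -/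
lemma expCPartial_mul_succ [IsUltrametricDist 𝕂] (hq : q = p ^ m) (hq2 : 2 ≤ q)
    (hθ : 1 < ‖θ‖) (z : 𝕂) (N : ℕ) :
    expCPartial q 𝕂 θ (θ * z) (N + 1) =
      θ * expCPartial q 𝕂 θ z (N + 1) + expCPartial q 𝕂 θ z N ^ q := by
  have hD : ∀ i : ℕ, ∏ j ∈ Finset.range (i + 1), (θ ^ q ^ (i + 1) - θ ^ q ^ j) =
      (∏ j ∈ Finset.range i, (θ ^ q ^ i - θ ^ q ^ j)) ^ q * (θ ^ q ^ (i + 1) - θ) := fun i => by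
    rw [Finset.prod_range_succ', ← Finset.prod_pow]
    congr 1
    · refine Finset.prod_congr rfl fun j _ => ?_
      rw [sub_pow_of_eq_prime_pow hq, ← pow_mul, ← pow_mul, pow_succ, pow_succ]
    · simp
  have hne : ∀ i : ℕ, θ ^ q ^ (i + 1) - θ ≠ 0 := fun i => by
    rw [← norm_pos_iff, norm_sub_rev, norm_sub_pow_pow hq2 hθ (by omega)]
    positivity
  unfold expCPartial
  rw [sum_pow_of_eq_prime_pow hq, ← sub_eq_iff_eq_add', Finset.mul_sum,
    ← Finset.sum_sub_distrib, Finset.sum_range_succ']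
  simp only [pow_zero, pow_one, Finset.range_zero, Finset.prod_empty, inv_one, mul_one, sub_self,
    add_zero]
  refine Finset.sum_congr rfl fun i _ => ?_
  rw [hD, mul_inv, mul_pow, mul_pow, ← pow_mul, ← pow_succ, inv_pow]
  have := hne i
  field_simp

/-- The functional equation `log_C (θ x + x ^ q) = θ log_C x` on partial sums. -/
lemma logCPartial_mul_add_pow [IsUltrametricDist 𝕂] (hq : q = p ^ m) (hq2 : 2 ≤ q)
    (hθ : 1 < ‖θ‖) (x : 𝕂) (N : ℕ) :
    logCPartial q 𝕂 θ (θ * x + x ^ q) (N + 1) = θ * logCPartial q 𝕂 θ x (N + 1) +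
      x ^ q ^ (N + 1) * (∏ j ∈ Finset.Icc 1 N, (θ - θ ^ q ^ j))⁻¹ := by
  induction N with
  | zero => simp [logCPartial]
  | succ N ih =>
    unfold logCPartial at ih ⊢
    rw [Finset.sum_range_succ, ih, Finset.sum_range_succ _ (N + 1), add_pow_of_eq_prime_pow hq,
      Finset.prod_Icc_succ_top (by omega), mul_inv, mul_pow, ← pow_mul x q, ← pow_succ']
    have hne : θ - θ ^ q ^ (N + 1) ≠ 0 := by
      rw [← norm_pos_iff, norm_sub_pow_pow hq2 hθ (by omega)]
      positivity
    have hinv := mul_inv_cancel₀ hne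
    generalize (∏ j ∈ Finset.Icc 1 N, (θ - θ ^ q ^ j))⁻¹ = L
    linear_combination (-x ^ q ^ (N + 1) * L) * hinv

lemma tendsto_expCPartial_mul [IsUltrametricDist 𝕂] (hq : q = p ^ m) (hq2 : 2 ≤ q)
    (hθ : 1 < ‖θ‖) {z x : 𝕂} (h : Tendsto (expCPartial q 𝕂 θ z) atTop (nhds x)) :
    Tendsto (expCPartial q 𝕂 θ (θ * z)) atTop (nhds (θ * x + x ^ q)) := by
  rw [← tendsto_add_atTop_iff_nat 1]
  simp only [expCPartial_mul_succ hq hq2 hθ]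
  exact (((tendsto_add_atTop_iff_nat 1).2 h).const_mul θ).add (h.pow q)

lemma tendsto_logCPartial_mul_add_pow [IsUltrametricDist 𝕂] (hq : q = p ^ m)
    (hq2 : 2 ≤ q) (hθ : 1 < ‖θ‖) {x l : 𝕂} (hx : ‖x‖ < 1)
    (h : Tendsto (logCPartial q 𝕂 θ x) atTop (nhds l)) :
    Tendsto (logCPartial q 𝕂 θ (θ * x + x ^ q)) atTop (nhds (θ * l)) := by
  rw [← tendsto_add_atTop_iff_nat 1]
  simp only [logCPartial_mul_add_pow hq hq2 hθ]
  rw [← add_zero (θ * l)]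
  refine (((tendsto_add_atTop_iff_nat 1).2 h).const_mul θ).add ?_
  refine squeeze_zero_norm (fun N => ?_)
    (tendsto_pow_atTop_nhds_zero_of_lt_one (norm_nonneg x) hx)
  rw [norm_mul, norm_pow]
  refine (mul_le_of_le_one_right (by positivity) (norm_logC_coeff_le_one hq2 hθ N)).trans
    (pow_le_pow_of_le_one (norm_nonneg x) hx.le ?_)
  exact N.le_succ.trans (Nat.lt_pow_self hq2).le

/-- On the open unit disc, `log_C` is a left inverse of `exp_C`. -/
lemma eq_of_tendsto_expCPartial_of_tendsto_logCPartial [CompleteSpace 𝕂] [IsUltrametricDist 𝕂]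
    (hq : q = p ^ m) (hq2 : 2 ≤ q) (hθ : 1 < ‖θ‖) {z x l : 𝕂} (hz : ‖z‖ < 1)
    (hx : Tendsto (expCPartial q 𝕂 θ z) atTop (nhds x))
    (hl : Tendsto (logCPartial q 𝕂 θ x) atTop (nhds l)) : l = z := by
  have hθ0 : θ ≠ 0 := norm_pos_iff.1 (one_pos.trans hθ)
  have key : ∀ (n : ℕ) (z x l : 𝕂), ‖z‖ < 1 → Tendsto (expCPartial q 𝕂 θ z) atTop (nhds x) →
      Tendsto (logCPartial q 𝕂 θ x) atTop (nhds l) → ‖l - z‖ ≤ ‖z‖ ^ 2 * ‖θ‖⁻¹ ^ n := by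
    intro n
    induction n with
    | zero =>
      intro z x l hz hx hl
      obtain ⟨x', hx', hxz⟩ := exists_tendsto_expCPartial hq2 hθ hz
      obtain rfl := tendsto_nhds_unique hx hx'
      have hnorm := norm_eq_of_norm_sub_le_sq hz hxz
      obtain ⟨l', hl', hlx⟩ := exists_tendsto_logCPartial hq2 hθ (hnorm.trans_lt hz)
      obtain rfl := tendsto_nhds_unique hl hl'
      rw [hnorm] at hlx
      rw [pow_zero, mul_one, ← sub_add_sub_cancel l x z]
      exact (IsUltrametricDist.norm_add_le_max _ _).trans (max_le hlx hxz)
    | succ n ih =>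
      intro z x l hz hx hl
      have hwn : ‖θ⁻¹ * z‖ = ‖θ‖⁻¹ * ‖z‖ := by rw [norm_mul, norm_inv]
      have hw : ‖θ⁻¹ * z‖ < 1 := hwn.trans_lt
        ((mul_le_of_le_one_left (norm_nonneg z) (inv_le_one_of_one_le₀ hθ.le)).trans_lt hz)
      obtain ⟨y, hy, hyw⟩ := exists_tendsto_expCPartial hq2 hθ hw
      have hyn : ‖y‖ < 1 := (norm_eq_of_norm_sub_le_sq hw hyw).trans_lt hw
      obtain ⟨k, hk, -⟩ := exists_tendsto_logCPartial hq2 hθ hyn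
      have hx' := tendsto_expCPartial_mul hq hq2 hθ hy
      rw [mul_inv_cancel_left₀ hθ0] at hx'
      obtain rfl := tendsto_nhds_unique hx hx'
      obtain rfl := tendsto_nhds_unique hl (tendsto_logCPartial_mul_add_pow hq hq2 hθ hyn hk)
      calc ‖θ * k - z‖ = ‖θ‖ * ‖k - θ⁻¹ * z‖ := by
            rw [← norm_mul, mul_sub, mul_inv_cancel_left₀ hθ0]
        _ ≤ ‖θ‖ * (‖θ⁻¹ * z‖ ^ 2 * ‖θ‖⁻¹ ^ n) := by gcongr; exact ih _ _ _ hw hy hk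
        _ = ‖z‖ ^ 2 * ‖θ‖⁻¹ ^ (n + 1) := by
            have hinv := mul_inv_cancel₀ (norm_ne_zero_iff.2 hθ0)
            rw [hwn]
            linear_combination (‖z‖ ^ 2 * ‖θ‖⁻¹ ^ (n + 1)) * hinv
  have hlim : Tendsto (fun n : ℕ => ‖z‖ ^ 2 * ‖θ‖⁻¹ ^ n) atTop (nhds (‖z‖ ^ 2 * 0)) :=
    (tendsto_pow_atTop_nhds_zero_of_lt_one (by positivity) (inv_lt_one_of_one_lt₀ hθ)).const_mul _
  rw [mul_zero] at hlim
  have h0 : ‖l - z‖ ≤ 0 := ge_of_tendsto' hlim fun n => key n z x l hz hx hl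
  exact sub_eq_zero.1 (norm_le_zero_iff.1 h0)

lemma isAlgebraic_of_mul_add_pow (hq : 2 ≤ q) {x : 𝕂}
    (h : IsAlgebraic (kk q 𝕂 θ) (θ * x + x ^ q)) : IsAlgebraic (kk q 𝕂 θ) x := by
  let t : kk q 𝕂 θ := ⟨θ, Subfield.subset_closure (by simp)⟩
  have hdeg : (Polynomial.C t * Polynomial.X).degree <
      (Polynomial.X ^ q : Polynomial (kk q 𝕂 θ)).degree := by
    rw [Polynomial.degree_X_pow]
    refine (Polynomial.degree_C_mul_X_le t).trans_lt ?_
    exact_mod_cast hq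
  refine IsAlgebraic.of_aeval (Polynomial.C t * Polynomial.X + Polynomial.X ^ q) ?_ ?_ ?_
  · rw [Polynomial.natDegree_add_eq_right_of_degree_lt hdeg, Polynomial.natDegree_X_pow]
    omega
  · rw [Polynomial.leadingCoeff_add_of_degree_lt hdeg, Polynomial.leadingCoeff_X_pow]
    exact one_mem _
  · simpa [t, Subfield.algebraMap_ofSubfield] using h

lemma isAlgebraic_of_tendsto_expCPartial_pow_mul [IsUltrametricDist 𝕂]
    (hq : q = p ^ m) (hq2 : 2 ≤ q) (hθ : 1 < ‖θ‖) (n : ℕ) {z x e : 𝕂}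
    (hx : Tendsto (expCPartial q 𝕂 θ z) atTop (nhds x))
    (he : Tendsto (expCPartial q 𝕂 θ (θ ^ n * z)) atTop (nhds e))
    (halg : IsAlgebraic (kk q 𝕂 θ) e) : IsAlgebraic (kk q 𝕂 θ) x := by
  induction n generalizing z x with
  | zero =>
    rw [pow_zero, one_mul] at he
    exact tendsto_nhds_unique hx he ▸ halg
  | succ n ih =>
    rw [pow_succ, mul_assoc] at he
    exact isAlgebraic_of_mul_add_pow hq2 (ih (tendsto_expCPartial_mul hq hq2 hθ hx) he)

end Frobenius

end Carlitz

/-- **Paper's Lemma `LogReduction` (Lemma 6.4.1).**  If `λ ∈ 𝕂` is nonzero and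
`exp_C(λ)` is a nonzero element of `k̄`, then `λ = θ^n·log_C(α) + f(θ)·π̃` for some
`α ∈ k̄ˣ` with `|α| < q^{q/(q-1)}`, some `f ∈ 𝔽_q[θ]` and some `n ≥ 1`. -/
theorem log_reduction
    (p m q : ℕ) [Fact p.Prime] (hm : 0 < m) (hq : q = p ^ m)
    (𝕂 : Type) [NormedField 𝕂] [CompleteSpace 𝕂] [IsAlgClosed 𝕂] [CharP 𝕂 p]
    (hna : IsNonarchimedean (fun x : 𝕂 => ‖x‖))
    (θ : 𝕂) (hθ : ‖θ‖ = q)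
    (hdense : Dense {x : 𝕂 | IsAlgebraic ((kk q 𝕂 θ).topologicalClosure) x})
    -- the Carlitz period `π̃`, defined from a fixed `(q-1)`-st root `ζ` of `-θ`
    (ζ : 𝕂) (hζ : ζ ^ (q - 1) = -θ)
    (πt : 𝕂)
    (hπ : Tendsto
      (fun N : ℕ => θ * ζ * ∏ i ∈ Finset.Icc 1 N, (1 - θ ^ ((1 : ℤ) - (q : ℤ) ^ i))⁻¹)
      atTop (nhds πt))
    -- `λ ≠ 0` with `exp_C(λ) = e` a nonzero element of `k̄`
    (lam : 𝕂) (hlam : lam ≠ 0)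
    (e : 𝕂) (he : Tendsto (expCPartial q 𝕂 θ lam) atTop (nhds e))
    (healg : IsAlgebraic (kk q 𝕂 θ) e) (he0 : e ≠ 0) :
    ∃ (α : 𝕂) (n : ℕ) (f : Polynomial 𝕂) (l : 𝕂),
      α ≠ 0 ∧ IsAlgebraic (kk q 𝕂 θ) α ∧
      ‖α‖ < (q : ℝ) ^ ((q : ℝ) / ((q : ℝ) - 1)) ∧
      (∀ j, (f.coeff j) ^ q = f.coeff j) ∧
      1 ≤ n ∧
      Tendsto (logCPartial q 𝕂 θ α) atTop (nhds l) ∧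
      lam = θ ^ n * l + f.eval θ * πt := by
  have := IsUltrametricDist.isUltrametricDist_of_isNonarchimedean_norm hna
  have hq2 : 2 ≤ q := by
    rw [hq]
    exact Nat.one_lt_pow hm.ne' (Fact.out : p.Prime).one_lt
  have hqR : (1 : ℝ) < q := by exact_mod_cast hq2
  have hθ1 : 1 < ‖θ‖ := hθ ▸ hqR
  have hθ0 : θ ≠ 0 := norm_pos_iff.1 (one_pos.trans hθ1)
  obtain ⟨n, hn⟩ := pow_unbounded_of_one_lt ‖lam‖ hθ1
  have hn' : ‖lam‖ < ‖θ‖ ^ (n + 1) := hn.trans (pow_lt_pow_right₀ hθ1 n.lt_succ_self)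
  obtain ⟨z, rfl⟩ : ∃ z, lam = θ ^ (n + 1) * z :=
    ⟨(θ ^ (n + 1))⁻¹ * lam, (mul_inv_cancel_left₀ (pow_ne_zero _ hθ0) lam).symm⟩
  have hz : ‖z‖ < 1 := by
    rw [norm_mul, norm_pow] at hn'
    exact (mul_lt_iff_lt_one_right (by positivity)).1 hn'
  obtain ⟨α, hα, hαz⟩ := exists_tendsto_expCPartial hq2 hθ1 hz
  have hnorm := norm_eq_of_norm_sub_le_sq hz hαz
  have hα1 : ‖α‖ < 1 := hnorm.trans_lt hz
  obtain ⟨l, hl, -⟩ := exists_tendsto_logCPartial hq2 hθ1 hα1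
  refine ⟨α, n + 1, 0, l, ?_,
    isAlgebraic_of_tendsto_expCPartial_pow_mul hq hq2 hθ1 (n + 1) hα he healg,
    hα1.trans_le (Real.one_le_rpow hqR.le (div_nonneg (by linarith) (by linarith))),
    fun j => ?_, by omega, hl, ?_⟩
  · rw [← norm_ne_zero_iff, hnorm, norm_ne_zero_iff]
    exact right_ne_zero_of_mul hlam
  · rw [Polynomial.coeff_zero, zero_pow (by omega)]
  · rw [eq_of_tendsto_expCPartial_of_tendsto_logCPartial hq hq2 hθ1 hz hα hl]
    simp
end
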